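/- Let t ∈ PT_n, let ω be a weight of length n, let P = P_{(t,ω)} be the Loday realization of the operahedron, and let v ∈ ℝ^{n−1} be a principal orientation vector. For nonempty faces F, G of P with associated nestings 𝒩 and 𝒩', one has (F,G) ∈ Im Δ_{(P,v)} if and only if for every (I,J) ∈ D(n−1) there exists a nest N ∈ 𝒩 with |N∩I| > |N∩J| or there exists a nest N' ∈ 𝒩' with |N'∩I| < |N'∩J|. -/

import Mathlib

open scoped BigOperators

noncomputable section

/-- Vectors in `ℝⁿ`. -/
abbrev Vec (n : ℕ) := Fin n → ℝ

/-- The standard scalar product on `ℝⁿ`. -/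
def dot {n : ℕ} (x y : Vec n) : ℝ := ∑ i, x i * y i

/-- A polytope is the convex hull of a finite set of points. -/
def IsPolytope {n : ℕ} (P : Set (Vec n)) : Prop :=
  ∃ S : Finset (Vec n), P = convexHull ℝ (S : Set (Vec n))

/-- A face of `P`: either `P` itself (take `c = 0`) or the subset of `P` where some linear
functional attains its maximum over `P`. -/
def IsFace {n : ℕ} (P F : Set (Vec n)) : Prop :=
  ∃ c : Vec n, F = {x ∈ P | ∀ y ∈ P, dot c y ≤ dot c x}

/-- Dimension of a subset of `ℝⁿ`: the rank of the direction of its affine span. -/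
noncomputable def sdim {n : ℕ} (A : Set (Vec n)) : ℕ :=
  Module.finrank ℝ (affineSpan ℝ A).direction

/-- The normal cone of a face `F` of `P`. -/
def normalCone {n : ℕ} (P F : Set (Vec n)) : Set (Vec n) :=
  {c | F ⊆ {x ∈ P | ∀ y ∈ P, dot c y ≤ dot c x}}

/-- `coneOf X`: nonnegative linear combinations of finitely many elements of `X`. -/
def coneOf {n : ℕ} (X : Set (Vec n)) : Set (Vec n) :=
  {v | ∃ (k : ℕ) (x : Fin k → Vec n) (l : Fin k → ℝ),
      (∀ i, x i ∈ X) ∧ (∀ i, 0 ≤ l i) ∧ v = ∑ i, l i • x i}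

/-- The reflection `ρ_z P = 2z - P` of `P` with respect to `z`. -/
def reflP {n : ℕ} (z : Vec n) (P : Set (Vec n)) : Set (Vec n) :=
  (fun x => (2 : ℝ) • z - x) '' P

/-- An edge is a 1-dimensional face. -/
def IsEdge {n : ℕ} (P E : Set (Vec n)) : Prop := IsFace P E ∧ sdim E = 1

/-- `(P, v)` is oriented if `v` is not perpendicular to any edge of `P`. -/
def Oriented {n : ℕ} (P : Set (Vec n)) (v : Vec n) : Prop :=
  ∀ E, IsEdge P E → ∀ d ∈ (affineSpan ℝ E).direction, d ≠ 0 → dot d v ≠ 0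

/-- `(P, v)` is positively oriented if `(P ∩ ρ_z P, v)` is oriented for every `z ∈ P`. -/
def PosOriented {n : ℕ} (P : Set (Vec n)) (v : Vec n) : Prop :=
  ∀ z ∈ P, Oriented (P ∩ reflP z P) v

/-- `x` is the minimizer of `⟨-, v⟩` on `P`. -/
def IsBotOf {n : ℕ} (P : Set (Vec n)) (v x : Vec n) : Prop :=
  x ∈ P ∧ ∀ y ∈ P, dot v x ≤ dot v y

/-- `x` is the maximizer of `⟨-, v⟩` on `P`. -/
def IsTopOf {n : ℕ} (P : Set (Vec n)) (v x : Vec n) : Prop :=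
  x ∈ P ∧ ∀ y ∈ P, dot v y ≤ dot v x

/-- `(P, v)` is quasi-oriented if `⟨-, v⟩` has a unique minimizer and a unique maximizer on `P`. -/
def QuasiOriented {n : ℕ} (P : Set (Vec n)) (v : Vec n) : Prop :=
  (∃! x, IsBotOf P v x) ∧ (∃! x, IsTopOf P v x)

/-- `(P, v)` is quasi-positively oriented if `(P ∩ ρ_z P, v)` is quasi-oriented for all `z ∈ P`. -/
def QuasiPosOriented {n : ℕ} (P : Set (Vec n)) (v : Vec n) : Prop :=
  ∀ z ∈ P, QuasiOriented (P ∩ reflP z P) v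

/-- The polytope `P^φ = π^φ(P × P) ⊆ ℝ^{n+1}`, where `π^φ(x,y) = ((x+y)/2, ⟨x - y, v⟩)`. -/
def Pphi {n : ℕ} (P : Set (Vec n)) (v : Vec n) : Set (Vec (n + 1)) :=
  {w | ∃ x ∈ P, ∃ y ∈ P, w = Fin.snoc ((1 / 2 : ℝ) • (x + y)) (dot (x - y) v)}

/-- The pair of faces `(F, G)` belongs to `F^φ`: there are no `x ∈ F`, `y ∈ G`, `λ > 0` with
`(π(x,y), φ(x,y) - λ) ∈ P^φ`. -/
def InFphi {n : ℕ} (P : Set (Vec n)) (v : Vec n) (F G : Set (Vec n)) : Prop :=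
  ¬ ∃ x ∈ F, ∃ y ∈ G, ∃ lam : ℝ, 0 < lam ∧
      (Fin.snoc ((1 / 2 : ℝ) • (x + y)) (dot (x - y) v - lam) : Vec (n + 1)) ∈ Pphi P v

/-- The set `(A + B)/2`. -/
def avgSet {n : ℕ} (A B : Set (Vec n)) : Set (Vec n) :=
  {z | ∃ x ∈ A, ∃ y ∈ B, z = (1 / 2 : ℝ) • (x + y)}

/-- The coherent subdivision `π(F^φ)` is tight. -/
def TightSub {n : ℕ} (P : Set (Vec n)) (v : Vec n) : Prop :=
  ∀ F G : Set (Vec n), IsFace P F → IsFace P G → F.Nonempty → G.Nonempty →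
    InFphi P v F G → sdim F + sdim G = sdim (avgSet F G)

/-- `d` is a direction of an edge of `P ∩ ρ_z P` for some `z ∈ P`; the hyperplanes of the
fundamental hyperplane arrangement `H_P` are the orthogonal complements of such directions. -/
def EdgeDir {n : ℕ} (P : Set (Vec n)) (d : Vec n) : Prop :=
  d ≠ 0 ∧ ∃ z ∈ P, ∃ E, IsEdge (P ∩ reflP z P) E ∧ d ∈ (affineSpan ℝ E).direction

/-- The cone `cone(-N_P(F) ∪ N_P(G))`. -/
def diagCone {n : ℕ} (P F G : Set (Vec n)) : Set (Vec n) :=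
  coneOf ((Neg.neg '' normalCone P F) ∪ normalCone P G)


/-- A planar rooted tree with `n` internal vertices labelled `0, …, n-1` in the clockwise-from-root
(depth-first preorder) order; `parent v` is the parent of the vertex `v`, the root being vertex `0`.
The internal edge `e : Fin (n-1)` connects the vertex `e+1` to its parent. -/
structure PTree (n : ℕ) where
  parent : Fin n → Fin n
  parent_zero : ∀ v : Fin n, v.val = 0 → parent v = v
  parent_lt : ∀ v : Fin n, 0 < v.val → (parent v).val < v.val
  preorder : ∀ v w : Fin n, w.val = v.val + 1 → ∃ k : ℕ, parent^[k] v = parent w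

/-- The child endpoint of the edge `e`: the vertex labelled `e + 1`. -/
def childV {n : ℕ} (e : Fin (n - 1)) : Fin n :=
  ⟨e.val + 1, by have h := e.isLt; omega⟩

/-- The vertices of the closure of a set of edges `N`, i.e. `V(t(N))`. -/
def nestVtx {n : ℕ} (t : PTree n) (N : Finset (Fin (n - 1))) : Finset (Fin n) :=
  N.biUnion fun e => {childV e, t.parent (childV e)}

/-- Two distinct edges are adjacent when they share a vertex. -/
def edgeAdj {n : ℕ} (t : PTree n) (e f : Fin (n - 1)) : Prop :=
  e ≠ f ∧ (({childV e, t.parent (childV e)} ∩ {childV f, t.parent (childV f)} :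
      Finset (Fin n))).Nonempty

instance {n : ℕ} (t : PTree n) (e f : Fin (n - 1)) : Decidable (edgeAdj t e f) := by
  unfold edgeAdj; infer_instance

/-- A nest: a set of edges whose closure is a connected subgraph (the trivial nest `E(t)` is
also allowed when `n = 1`, where it is empty). -/
def IsNest {n : ℕ} (t : PTree n) (N : Finset (Fin (n - 1))) : Prop :=
  (N.Nonempty ∨ N = Finset.univ) ∧
    ∀ e ∈ N, ∀ f ∈ N,
      Relation.ReflTransGen (fun a b => a ∈ N ∧ b ∈ N ∧ edgeAdj t a b) e f

/-- A nesting: a set of nests containing the trivial nest, any two of which are nested or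
disjoint, disjoint ones having no adjacent edges. -/
def IsNesting {n : ℕ} (t : PTree n) (𝒩 : Finset (Finset (Fin (n - 1)))) : Prop :=
  (∀ N ∈ 𝒩, IsNest t N) ∧ Finset.univ ∈ 𝒩 ∧
    ∀ N ∈ 𝒩, ∀ M ∈ 𝒩,
      N ⊆ M ∨ M ⊆ N ∨ (Disjoint N M ∧ ∀ e ∈ N, ∀ f ∈ M, ¬ edgeAdj t e f)

/-- A maximal nesting: a nesting of (maximal) cardinality `n - 1`. -/
def IsMaxNesting {n : ℕ} (t : PTree n) (𝒩 : Finset (Finset (Fin (n - 1)))) : Prop :=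
  IsNesting t 𝒩 ∧ 𝒩.card = n - 1

/-- `min 𝒩(i)`: the smallest nest of `𝒩` containing the edge `i` (the nests of a nesting
containing `i` being totally ordered, this is their intersection). -/
def minNest {n : ℕ} (𝒩 : Finset (Finset (Fin (n - 1)))) (i : Fin (n - 1)) :
    Finset (Fin (n - 1)) :=
  (𝒩.filter fun N => i ∈ N).inf id

/-- `u` is a weak ancestor of `w` (any ancestor is reached in at most `n` steps). -/
def isAnc {n : ℕ} (t : PTree n) (u w : Fin n) : Prop :=
  ∃ k ∈ Finset.range (n + 1), t.parent^[k] w = u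

instance {n : ℕ} (t : PTree n) (u w : Fin n) : Decidable (isAnc t u w) := by
  unfold isAnc; infer_instance

/-- `α_i`: the total weight of the subtree `t₁` of `t(min𝒩(i))` having the edge `i` as root. -/
def alphaN {n : ℕ} (t : PTree n) (𝒩 : Finset (Finset (Fin (n - 1))))
    (ω : Fin n → ℤ) (i : Fin (n - 1)) : ℤ :=
  ∑ w ∈ (nestVtx t (minNest 𝒩 i)).filter (fun w => isAnc t (childV i) w), ω w

/-- `β_i`: the total weight of the subtree `t₂` of `t(min𝒩(i))` having the edge `i` as a leaf. -/
def betaN {n : ℕ} (t : PTree n) (𝒩 : Finset (Finset (Fin (n - 1))))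
    (ω : Fin n → ℤ) (i : Fin (n - 1)) : ℤ :=
  ∑ w ∈ (nestVtx t (minNest 𝒩 i)).filter (fun w => ¬ isAnc t (childV i) w), ω w

/-- The point `M(t, 𝒩, ω) = (α₁β₁, …, α_{n-1}β_{n-1})`. -/
noncomputable def MPoint {n : ℕ} (t : PTree n) (𝒩 : Finset (Finset (Fin (n - 1))))
    (ω : Fin n → ℤ) : Vec (n - 1) :=
  fun i => ((alphaN t 𝒩 ω i : ℤ) : ℝ) * ((betaN t 𝒩 ω i : ℤ) : ℝ)

/-- The Loday realization `P_{(t,ω)}` of the operahedron. -/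
noncomputable def Loday {n : ℕ} (t : PTree n) (ω : Fin n → ℤ) : Set (Vec (n - 1)) :=
  convexHull ℝ {x | ∃ 𝒩, IsMaxNesting t 𝒩 ∧ x = MPoint t 𝒩 ω}

/-- The face of `P_{(t,ω)}` associated to a nesting `𝒩`: the convex hull of the points
`M(t,𝒩',ω)` over the maximal nestings `𝒩' ⊇ 𝒩`. -/
noncomputable def faceOfNesting {n : ℕ} (t : PTree n) (ω : Fin n → ℤ)
    (𝒩 : Finset (Finset (Fin (n - 1)))) : Set (Vec (n - 1)) :=
  convexHull ℝ {x | ∃ 𝒩', IsMaxNesting t 𝒩' ∧ 𝒩 ⊆ 𝒩' ∧ x = MPoint t 𝒩' ω}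

/-- A pair `(I, J) ∈ D(m)`: disjoint subsets of the same cardinality with `min (I ∪ J) ∈ I`. -/
def DPair {m : ℕ} (I J : Finset (Fin m)) : Prop :=
  I.card = J.card ∧ Disjoint I J ∧ ∃ i ∈ I, ∀ x ∈ I ∪ J, i ≤ x

/-- A trinary vector: all coordinates are `0`, `1` or `-1`. -/
def Trinary {m : ℕ} (u : Vec m) : Prop := ∀ i, u i = 0 ∨ u i = 1 ∨ u i = -1

/-- A balanced vector: same number of coordinates equal to `1` and to `-1`. -/
def BalancedVec {m : ℕ} (u : Vec m) : Prop :=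
  (Finset.univ.filter fun i => u i = 1).card = (Finset.univ.filter fun i => u i = -1).card

/-- The first nonzero coordinate is `1`. -/
def FirstPos {m : ℕ} (u : Vec m) : Prop :=
  ∀ i, u i ≠ 0 → (∀ j, j < i → u j = 0) → u i = 1

/-- Any two members of the family are nested or disjoint. -/
def Laminar {ι : Type*} (A : Finset (Finset ι)) : Prop :=
  ∀ N ∈ A, ∀ M ∈ A, N ⊆ M ∨ M ⊆ N ∨ Disjoint N M

theorem Laminar.mono {ι : Type*} {A B : Finset (Finset ι)} (hB : Laminar B) (h : A ⊆ B) :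
    Laminar A :=
  fun N hN M hM => hB N (h hN) M (h hM)

theorem Laminar.sum_biUnion_nonneg {ι : Type*} [DecidableEq ι] {A : Finset (Finset ι)}
    (hA : Laminar A) {d : ι → ℝ} (h : ∀ N ∈ A, 0 ≤ ∑ e ∈ N, d e) :
    0 ≤ ∑ e ∈ A.biUnion id, d e := by
  induction hk : A.card using Nat.strong_induction_on generalizing A with
  | _ k ih =>
    by_cases hex : ∃ N ∈ A, ∃ M ∈ A, N ≠ M ∧ N ⊆ M
    · obtain ⟨N, hN, M, hM, hne, hsub⟩ := hex
      have hU : A.biUnion id = (A.erase N).biUnion id := by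
        ext x
        simp only [Finset.mem_biUnion, id, Finset.mem_erase]
        constructor
        · rintro ⟨L, hL, hx⟩
          by_cases hLN : L = N
          · exact ⟨M, ⟨hne.symm, hM⟩, hsub (hLN ▸ hx)⟩
          · exact ⟨L, ⟨hLN, hL⟩, hx⟩
        · rintro ⟨L, hL, hx⟩
          exact ⟨L, hL.2, hx⟩
      rw [hU]
      exact ih _ (hk ▸ Finset.card_erase_lt_of_mem hN) (hA.mono (Finset.erase_subset _ _))
        (fun L hL => h L (Finset.mem_of_mem_erase hL)) rfl
    · push Not at hex
      rw [Finset.sum_biUnion]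
      · exact Finset.sum_nonneg h
      · intro N hN M hM hne
        rcases hA N hN M hM with h1 | h1 | h1
        · exact absurd h1 (hex N hN M hM hne)
        · exact absurd h1 (hex M hM N hN hne.symm)
        · exact h1

/-- An element of positive weight can be matched with an element of negative weight so that the
transfer between them respects the signs of the weights of all members of a laminar family. -/
theorem Laminar.exists_neg_match {ι : Type*} [Fintype ι] [DecidableEq ι] {A : Finset (Finset ι)}
    (hA : Laminar A) (huniv : Finset.univ ∈ A) {d : ι → ℝ} (hd : ∑ e, d e = 0) {e : ι}
    (he : 0 < d e) :
    ∃ x, d x < 0 ∧ ∀ M ∈ A, (e ∈ M → x ∉ M → 0 < ∑ i ∈ M, d i) ∧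
      (e ∉ M → x ∈ M → ∑ i ∈ M, d i < 0) := by
  obtain ⟨N, hN, hmin⟩ := Finset.exists_min_image
    (A.filter fun N => e ∈ N ∧ ∑ i ∈ N, d i ≤ 0) Finset.card
    ⟨Finset.univ, by simp [huniv, hd]⟩
  simp only [Finset.mem_filter] at hN hmin
  obtain ⟨hNA, heN, hNd⟩ := hN
  by_contra hcon
  push Not at hcon
  set L : Finset (Finset ι) :=
    (A.filter fun M => M ⊆ N ∧ e ∉ M ∧ 0 ≤ ∑ i ∈ M, d i) ∪
      ((N.erase e).filter fun x => 0 ≤ d x).image singleton with hL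
  have hLam : Laminar L := by
    have key : ∀ (x : ι) (M : Finset ι), ({x} : Finset ι) ⊆ M ∨ Disjoint {x} M := fun x M => by
      by_cases hx : x ∈ M
      · exact Or.inl (Finset.singleton_subset_iff.2 hx)
      · exact Or.inr (Finset.disjoint_singleton_left.2 hx)
    intro P hP Q hQ
    simp only [hL, Finset.mem_union, Finset.mem_filter, Finset.mem_image] at hP hQ
    rcases hP with hP | ⟨x, -, rfl⟩
    · rcases hQ with hQ | ⟨x, -, rfl⟩
      · exact hA P hP.1 Q hQ.1
      · rcases key x P with h | h
        · exact Or.inr (Or.inl h)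
        · exact Or.inr (Or.inr h.symm)
    · rcases key x Q with h | h
      · exact Or.inl h
      · exact Or.inr (Or.inr h)
  have hLU : L.biUnion id = N.erase e := by
    ext x
    simp only [Finset.mem_biUnion, id, hL, Finset.mem_union, Finset.mem_filter, Finset.mem_image]
    constructor
    · rintro ⟨P, hP | ⟨y, hy, rfl⟩, hx⟩
      · exact Finset.mem_erase.2 ⟨fun h => hP.2.2.1 (h ▸ hx), hP.2.1 hx⟩
      · rw [Finset.mem_singleton.1 hx]; exact hy.1
    · intro hx
      by_cases hdx : 0 ≤ d x
      · exact ⟨{x}, Or.inr ⟨x, ⟨hx, hdx⟩, rfl⟩, by simp⟩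
      obtain ⟨hxe, hxN⟩ := Finset.mem_erase.1 hx
      obtain ⟨M, hMA, hM⟩ := hcon x (not_le.1 hdx)
      by_cases hfirst : e ∈ M → x ∉ M → 0 < ∑ i ∈ M, d i
      · obtain ⟨heM, hxM, hMd⟩ := hM hfirst
        refine ⟨M, Or.inl ⟨hMA, ?_, heM, hMd⟩, hxM⟩
        rcases hA N hNA M hMA with h | h | h
        · exact absurd (h heN) heM
        · exact h
        · exact absurd hxM (Finset.disjoint_left.1 h hxN)
      · exfalso
        push Not at hfirst
        obtain ⟨heM, hxM, hMd⟩ := hfirst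
        have hle := hmin M ⟨hMA, heM, hMd⟩
        rcases hA N hNA M hMA with h | h | h
        · exact hxM (h hxN)
        · have := Finset.card_lt_card (Finset.ssubset_iff_subset_ne.2
            ⟨h, fun hEq => hxM (hEq ▸ hxN)⟩)
          omega
        · exact Finset.disjoint_left.1 h heN heM
  have hpos : 0 ≤ ∑ i ∈ L.biUnion id, d i := by
    refine hLam.sum_biUnion_nonneg fun P hP => ?_
    simp only [hL, Finset.mem_union, Finset.mem_filter, Finset.mem_image] at hP
    rcases hP with hP | ⟨x, hx, rfl⟩
    · exact hP.2.2.2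
    · simpa using hx.2
  rw [hLU] at hpos
  have := Finset.add_sum_erase N d heN
  linarith

/-- A nonzero vector of total weight zero admits a nonzero trinary vector whose weights on the
elements and on the members of two laminar families are sign-compatible with those of `d`. -/
theorem exists_trinary_conformal {ι : Type*} [Fintype ι] [DecidableEq ι]
    {A B : Finset (Finset ι)} (hA : Laminar A) (hB : Laminar B) (hAu : Finset.univ ∈ A)
    (hBu : Finset.univ ∈ B) {d : ι → ℝ} (hd : ∑ e, d e = 0) (hd0 : d ≠ 0) :
    ∃ u : ι → ℝ, u ≠ 0 ∧ (∀ e, u e = 0 ∨ u e = 1 ∨ u e = -1) ∧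
      (∀ e, (0 ≤ d e → 0 ≤ u e) ∧ (d e ≤ 0 → u e ≤ 0)) ∧
      ∀ S ∈ A ∪ B, (0 ≤ ∑ e ∈ S, d e → 0 ≤ ∑ e ∈ S, u e) ∧
        (∑ e ∈ S, d e ≤ 0 → ∑ e ∈ S, u e ≤ 0) := by
  classical
  have hnext : ∀ e, ∃ x, (0 < d e → d x < 0 ∧ ∀ M ∈ A,
        (e ∈ M → x ∉ M → 0 < ∑ i ∈ M, d i) ∧ (e ∉ M → x ∈ M → ∑ i ∈ M, d i < 0)) ∧
      (d e < 0 → 0 < d x ∧ ∀ M ∈ B,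
        (e ∈ M → x ∉ M → ∑ i ∈ M, d i < 0) ∧ (e ∉ M → x ∈ M → 0 < ∑ i ∈ M, d i)) := by
    intro e
    rcases lt_trichotomy (d e) 0 with h | h | h
    · obtain ⟨x, hx, hM⟩ := hB.exists_neg_match hBu (d := -d) (by simp [hd]) (e := e)
        (by simpa using h)
      refine ⟨x, fun h' => absurd h h'.not_gt, fun _ => ⟨by simpa using hx, fun M hMB => ?_⟩⟩
      simpa using hM M hMB
    · exact ⟨e, fun h' => absurd h h'.ne', fun h' => absurd h h'.ne⟩
    · obtain ⟨x, hx, hM⟩ := hA.exists_neg_match hAu hd h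
      exact ⟨x, fun _ => ⟨hx, hM⟩, fun h' => absurd h h'.not_gt⟩
  choose g hgpos hgneg using hnext
  have hg0 : ∀ e, d e ≠ 0 → d (g e) ≠ 0 := by
    intro e he
    rcases lt_or_gt_of_ne he with h | h
    · exact (hgneg e h).1.ne'
    · exact (hgpos e h).1.ne
  set Wp : Finset ι := Finset.univ.filter fun e => e ∈ Function.periodicPts g ∧ 0 < d e with hWp
  set Wn : Finset ι := Finset.univ.filter fun e => e ∈ Function.periodicPts g ∧ d e < 0 with hWn
  have hbij := Function.bijOn_periodicPts g
  have hsurj : ∀ y ∈ Function.periodicPts g, d y ≠ 0 →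
      ∃ x ∈ Function.periodicPts g, d x ≠ 0 ∧ g x = y := by
    rintro y ⟨k, hk, hy⟩ hdy
    refine ⟨g^[k - 1] y, ?_, ?_, ?_⟩
    · exact Set.MapsTo.iterate hbij.mapsTo _ ⟨k, hk, hy⟩
    · generalize k - 1 = j
      induction j with
      | zero => simpa
      | succ j ih => rw [Function.iterate_succ_apply']; exact hg0 _ ih
    · rw [← Function.iterate_succ_apply' g, Nat.succ_eq_add_one, Nat.sub_add_cancel hk]
      exact hy
  have hsum1 : ∀ φ : ι → ℝ, ∑ w ∈ Wn, φ w = ∑ w ∈ Wp, φ (g w) := by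
    intro φ
    symm
    refine Finset.sum_bij (fun w _ => g w) ?_ ?_ ?_ (fun _ _ => rfl)
    · intro w hw
      simp only [hWp, hWn, Finset.mem_filter, Finset.mem_univ, true_and] at hw ⊢
      exact ⟨hbij.mapsTo hw.1, (hgpos w hw.2).1⟩
    · intro w hw w' hw' h
      simp only [hWp, Finset.mem_filter, Finset.mem_univ, true_and] at hw hw'
      exact hbij.injOn hw.1 hw'.1 h
    · intro y hy
      simp only [hWn, Finset.mem_filter, Finset.mem_univ, true_and] at hy
      obtain ⟨x, hx, hdx, hxy⟩ := hsurj y hy.1 hy.2.ne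
      refine ⟨x, ?_, hxy⟩
      simp only [hWp, Finset.mem_filter, Finset.mem_univ, true_and]
      refine ⟨hx, lt_of_not_ge fun h => ?_⟩
      have := (hgneg x (lt_of_le_of_ne h hdx)).1
      rw [hxy] at this
      exact this.not_gt hy.2
  have hsum2 : ∀ φ : ι → ℝ, ∑ w ∈ Wp, φ w = ∑ w ∈ Wn, φ (g w) := by
    intro φ
    symm
    refine Finset.sum_bij (fun w _ => g w) ?_ ?_ ?_ (fun _ _ => rfl)
    · intro w hw
      simp only [hWp, hWn, Finset.mem_filter, Finset.mem_univ, true_and] at hw ⊢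
      exact ⟨hbij.mapsTo hw.1, (hgneg w hw.2).1⟩
    · intro w hw w' hw' h
      simp only [hWn, Finset.mem_filter, Finset.mem_univ, true_and] at hw hw'
      exact hbij.injOn hw.1 hw'.1 h
    · intro y hy
      simp only [hWp, Finset.mem_filter, Finset.mem_univ, true_and] at hy
      obtain ⟨x, hx, hdx, hxy⟩ := hsurj y hy.1 hy.2.ne'
      refine ⟨x, ?_, hxy⟩
      simp only [hWn, Finset.mem_filter, Finset.mem_univ, true_and]
      refine ⟨hx, lt_of_not_ge fun h => ?_⟩
      have := (hgpos x (lt_of_le_of_ne h hdx.symm)).1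
      rw [hxy] at this
      exact this.not_gt hy.2
  have hWmem : ∀ e, (e ∈ Wp → 0 < d e) ∧ (e ∈ Wn → d e < 0) := fun e => by
    simp only [hWp, hWn, Finset.mem_filter]
    exact ⟨fun h => h.2.2, fun h => h.2.2⟩
  set u : ι → ℝ := fun e => (if e ∈ Wp then 1 else 0) - (if e ∈ Wn then 1 else 0) with hu
  have huS : ∀ S : Finset ι, ∑ e ∈ S, u e =
      ∑ w ∈ Wp, (if w ∈ S then (1 : ℝ) else 0) - ∑ w ∈ Wn, (if w ∈ S then (1 : ℝ) else 0) := by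
    intro S
    simp only [hu, Finset.sum_sub_distrib, Finset.sum_ite_mem, Finset.inter_comm S]
  refine ⟨u, ?_, ?_, ?_, ?_⟩
  · obtain ⟨e, he⟩ := Function.ne_iff.1 hd0
    have hit : ∀ k, d (g^[k] e) ≠ 0 := fun k => by
      induction k with
      | zero => simpa using he
      | succ j ih => rw [Function.iterate_succ_apply']; exact hg0 _ ih
    obtain ⟨x, hx, hdx⟩ : ∃ x ∈ Function.periodicPts g, d x ≠ 0 := by
      obtain ⟨i, j, hij, heq⟩ := Finite.exists_ne_map_eq_of_infinite fun k => g^[k] e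
      wlog hlt : i < j generalizing i j
      · exact this j i hij.symm heq.symm (by omega)
      refine ⟨g^[i] e, ⟨j - i, by omega, ?_⟩, hit i⟩
      change g^[j - i] (g^[i] e) = g^[i] e
      rw [← Function.iterate_add_apply, Nat.sub_add_cancel hlt.le]
      exact heq.symm
    refine Function.ne_iff.2 ⟨x, ?_⟩
    rcases lt_or_gt_of_ne hdx with h | h
    · simp [hu, hWp, hWn, hx, h, h.not_gt]
    · simp [hu, hWp, hWn, hx, h, h.not_gt]
  · intro e
    simp only [hu]
    by_cases h1 : e ∈ Wp <;> by_cases h2 : e ∈ Wn <;> simp [h1, h2]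
  · intro e
    simp only [hu]
    obtain ⟨hp, hn⟩ := hWmem e
    constructor
    · intro hde
      have h2 : e ∉ Wn := fun h => (hn h).not_ge hde
      rw [if_neg h2, sub_zero]
      split_ifs <;> norm_num
    · intro hde
      have h1 : e ∉ Wp := fun h => (hp h).not_ge hde
      rw [if_neg h1, zero_sub]
      split_ifs <;> norm_num
  · intro S hS
    rw [huS]
    rcases Finset.mem_union.1 hS with hS | hS
    · rw [hsum1, ← Finset.sum_sub_distrib]
      constructor
      · intro hdS
        refine Finset.sum_nonneg fun w hw => ?_
        have := (hgpos w ((hWmem w).1 hw)).2 S hS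
        split_ifs with h1 h2 h2
        · norm_num
        · norm_num
        · exact absurd hdS (this.2 h1 h2).not_ge
        · norm_num
      · intro hdS
        refine Finset.sum_nonpos fun w hw => ?_
        have := (hgpos w ((hWmem w).1 hw)).2 S hS
        split_ifs with h1 h2 h2
        · norm_num
        · exact absurd hdS (this.1 h1 h2).not_ge
        · norm_num
        · norm_num
    · rw [hsum2, ← Finset.sum_sub_distrib]
      constructor
      · intro hdS
        refine Finset.sum_nonneg fun w hw => ?_
        have := (hgneg w ((hWmem w).2 hw)).2 S hS
        split_ifs with h1 h2 h2
        · norm_num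
        · norm_num
        · exact absurd hdS (this.1 h2 h1).not_ge
        · norm_num
      · intro hdS
        refine Finset.sum_nonpos fun w hw => ?_
        have := (hgneg w ((hWmem w).2 hw)).2 S hS
        split_ifs with h1 h2 h2
        · norm_num
        · exact absurd hdS (this.2 h2 h1).not_ge
        · norm_num
        · norm_num

/-- The cone cut out by sign conditions on the weights of two laminar families is generated by
trinary vectors: a functional that is positive somewhere on it is positive on a trinary vector. -/
theorem exists_trinary_of_pos {ι : Type*} [Fintype ι] [DecidableEq ι]
    {A B : Finset (Finset ι)} (hA : Laminar A) (hB : Laminar B) (hAu : Finset.univ ∈ A)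
    (hBu : Finset.univ ∈ B) (v : ι → ℝ) {d : ι → ℝ} (hdA : ∀ N ∈ A, ∑ e ∈ N, d e ≤ 0)
    (hdB : ∀ N ∈ B, 0 ≤ ∑ e ∈ N, d e) (hpos : 0 < ∑ e, v e * d e) :
    ∃ u : ι → ℝ, (∀ e, u e = 0 ∨ u e = 1 ∨ u e = -1) ∧ (∀ N ∈ A, ∑ e ∈ N, u e ≤ 0) ∧
      (∀ N ∈ B, 0 ≤ ∑ e ∈ N, u e) ∧ 0 < ∑ e, v e * u e := by
  classical
  set F : Finset (Finset ι) := (A ∪ B) ∪ Finset.univ.image singleton with hF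
  induction hk : (F.filter fun S => ∑ e ∈ S, d e ≠ 0).card using Nat.strong_induction_on
    generalizing d with
  | _ k ih =>
    have hd0 : d ≠ 0 := by
      rintro rfl
      simp at hpos
    have hdu : ∑ e, d e = 0 := le_antisymm (hdA _ hAu) (hdB _ hBu)
    obtain ⟨u, hu0, htri, hue, huS⟩ := exists_trinary_conformal hA hB hAu hBu hdu hd0
    have huA : ∀ N ∈ A, ∑ e ∈ N, u e ≤ 0 := fun N hN =>
      (huS N (Finset.mem_union_left _ hN)).2 (hdA N hN)
    have huB : ∀ N ∈ B, 0 ≤ ∑ e ∈ N, u e := fun N hN =>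
      (huS N (Finset.mem_union_right _ hN)).1 (hdB N hN)
    by_cases hvu : 0 < ∑ e, v e * u e
    · exact ⟨u, htri, huA, huB, hvu⟩
    have hconf : ∀ S ∈ F, (0 ≤ ∑ e ∈ S, d e → 0 ≤ ∑ e ∈ S, u e) ∧
        (∑ e ∈ S, d e ≤ 0 → ∑ e ∈ S, u e ≤ 0) := by
      intro S hS
      rcases Finset.mem_union.1 hS with hS | hS
      · exact huS S hS
      · obtain ⟨e, -, rfl⟩ := Finset.mem_image.1 hS
        simpa using hue e
    have hratio : ∀ S ∈ F, ∑ e ∈ S, u e ≠ 0 → 0 < (∑ e ∈ S, d e) / ∑ e ∈ S, u e := by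
      intro S hS hne
      obtain ⟨h1, h2⟩ := hconf S hS
      rcases lt_or_gt_of_ne hne with h | h
      · exact div_pos_of_neg_of_neg (lt_of_not_ge fun h' => (h1 h').not_gt h) h
      · exact div_pos (lt_of_not_ge fun h' => (h2 h').not_gt h) h
    obtain ⟨e₀, he₀⟩ := Function.ne_iff.1 hu0
    obtain ⟨S₀, hS₀, hmin⟩ := Finset.exists_min_image (F.filter fun S => ∑ e ∈ S, u e ≠ 0)
      (fun S => (∑ e ∈ S, d e) / ∑ e ∈ S, u e)
      ⟨{e₀}, by simpa [hF] using he₀⟩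
    simp only [Finset.mem_filter] at hS₀ hmin
    obtain ⟨lam, hlam⟩ : ∃ lam, lam = (∑ e ∈ S₀, d e) / ∑ e ∈ S₀, u e := ⟨_, rfl⟩
    have hlam0 : 0 < lam := hlam ▸ hratio S₀ hS₀.1 hS₀.2
    have hsum : ∀ S : Finset ι, ∑ e ∈ S, (d - lam • u) e =
        ∑ e ∈ S, d e - lam * ∑ e ∈ S, u e := fun S => by
      simp [Finset.sum_sub_distrib, Finset.mul_sum]
    have hle : ∀ S ∈ F, ∑ e ∈ S, u e ≠ 0 → lam ≤ (∑ e ∈ S, d e) / ∑ e ∈ S, u e :=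
      fun S hS hne => hlam ▸ hmin S ⟨hS, hne⟩
    refine ih _ ?_ (d := d - lam • u) ?_ ?_ ?_ rfl
    · rw [← hk]
      refine Finset.card_lt_card (Finset.ssubset_iff_of_subset ?_ |>.2 ⟨S₀, ?_, ?_⟩)
      · intro S hS
        simp only [Finset.mem_filter] at hS ⊢
        refine ⟨hS.1, fun h0 => hS.2 ?_⟩
        obtain ⟨h1, h2⟩ := hconf S hS.1
        rw [hsum, h0, le_antisymm (h2 h0.le) (h1 h0.ge)]
        simp
      · simp only [Finset.mem_filter]
        refine ⟨hS₀.1, fun h0 => ?_⟩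
        have := hratio S₀ hS₀.1 hS₀.2
        rw [h0, zero_div] at this
        exact this.false
      · simp only [Finset.mem_filter, not_and, not_not]
        intro _
        rw [hsum, hlam, div_mul_cancel₀ _ hS₀.2, sub_self]
    · intro N hN
      rw [hsum]
      have hNF : N ∈ F := by simp [hF, hN]
      rcases (huA N hN).lt_or_eq with h | h
      · have := (le_div_iff_of_neg h).1 (hle N hNF h.ne)
        linarith
      · rw [h]; simpa using hdA N hN
    · intro N hN
      rw [hsum]
      have hNF : N ∈ F := by simp [hF, hN]
      rcases (huB N hN).lt_or_eq with h | h
      · have := (le_div_iff₀ h).1 (hle N hNF h.ne')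
        linarith
      · rw [← h]; simpa using hdB N hN
    · have : ∑ e, v e * (d - lam • u) e = ∑ e, v e * d e - lam * ∑ e, v e * u e := by
        simp only [Pi.sub_apply, Pi.smul_apply, smul_eq_mul, mul_sub, Finset.sum_sub_distrib,
          Finset.mul_sum]
        congr 1
        exact Finset.sum_congr rfl fun e _ => by ring
      rw [this]
      nlinarith

/-- **Farkas' lemma** for finitely many vectors. -/
theorem farkas {ι m : Type*} [Fintype m] (s : Finset ι) (a : ι → m → ℝ) (b : m → ℝ)
    (h : ∀ x : m → ℝ, (∀ i ∈ s, a i ⬝ᵥ x ≤ 0) → b ⬝ᵥ x ≤ 0) :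
    ∃ l : ι → ℝ, (∀ i, 0 ≤ l i) ∧ b = ∑ i ∈ s, l i • a i := by
  classical
  induction s using Finset.induction_on generalizing a b with
  | empty =>
    refine ⟨0, fun _ => le_rfl, ?_⟩
    have h0 := h b (by simp)
    have h1 : 0 ≤ b ⬝ᵥ b := Finset.sum_nonneg fun i _ => mul_self_nonneg _
    simpa using dotProduct_self_eq_zero.1 (le_antisymm h0 h1)
  | insert j s hj ih =>
    by_cases hs : ∀ x : m → ℝ, (∀ i ∈ s, a i ⬝ᵥ x ≤ 0) → b ⬝ᵥ x ≤ 0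
    · obtain ⟨l, hl, hb⟩ := ih a b hs
      refine ⟨fun i => if i = j then 0 else l i,
        fun i => by dsimp only; split_ifs <;> simp [hl], ?_⟩
      rw [Finset.sum_insert hj, hb]
      simp only [if_true, zero_smul, zero_add]
      refine Finset.sum_congr rfl fun i hi => ?_
      rw [if_neg fun h : i = j => hj (h ▸ hi)]
    push Not at hs
    obtain ⟨x₁, hx₁, hbx₁⟩ := hs
    have hjx₁ : 0 < a j ⬝ᵥ x₁ := by
      by_contra hcon
      refine (h x₁ fun i hi => ?_).not_gt hbx₁
      rcases Finset.mem_insert.1 hi with rfl | hi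
      · exact not_lt.1 hcon
      · exact hx₁ i hi
    obtain ⟨x₀, hx₀, hbx₀, hjx₀⟩ : ∃ x₀ : m → ℝ, (∀ i ∈ s, a i ⬝ᵥ x₀ ≤ 0) ∧ 0 < b ⬝ᵥ x₀ ∧
        a j ⬝ᵥ x₀ = 1 := by
      refine ⟨(a j ⬝ᵥ x₁)⁻¹ • x₁, fun i hi => ?_, ?_, ?_⟩
      · rw [dotProduct_smul, smul_eq_mul]
        exact mul_nonpos_of_nonneg_of_nonpos (inv_nonneg.2 hjx₁.le) (hx₁ i hi)
      · rw [dotProduct_smul, smul_eq_mul]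
        exact mul_pos (inv_pos.2 hjx₁) hbx₁
      · rw [dotProduct_smul, smul_eq_mul, inv_mul_cancel₀ hjx₁.ne']
    obtain ⟨l, hl, hb⟩ := ih (fun i => a i - (a i ⬝ᵥ x₀) • a j) (b - (b ⬝ᵥ x₀) • a j) (by
      intro x hx
      have key : ∀ w : m → ℝ, (w - (w ⬝ᵥ x₀) • a j) ⬝ᵥ x = w ⬝ᵥ (x - (a j ⬝ᵥ x) • x₀) := by
        intro w
        simp only [sub_dotProduct, dotProduct_sub, smul_dotProduct, dotProduct_smul, smul_eq_mul]
        ring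
      rw [key]
      refine h _ fun i hi => ?_
      rcases Finset.mem_insert.1 hi with rfl | hi
      · simp [dotProduct_sub, dotProduct_smul, hjx₀]
      · rw [← key]; exact hx i hi)
    refine ⟨fun i => if i = j then b ⬝ᵥ x₀ - ∑ i ∈ s, l i * (a i ⬝ᵥ x₀) else l i, ?_, ?_⟩
    · intro i
      dsimp only
      split_ifs
      · have : ∑ i ∈ s, l i * (a i ⬝ᵥ x₀) ≤ 0 := Finset.sum_nonpos fun i hi =>
          mul_nonpos_of_nonneg_of_nonpos (hl i) (hx₀ i hi)
        linarith
      · exact hl i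
    · rw [Finset.sum_insert hj]
      have hc : ∑ i ∈ s, (if i = j then b ⬝ᵥ x₀ - ∑ i ∈ s, l i * (a i ⬝ᵥ x₀) else l i) • a i =
          ∑ i ∈ s, l i • a i := Finset.sum_congr rfl fun i hi => by
        rw [if_neg fun h : i = j => hj (h ▸ hi)]
      dsimp only
      rw [hc, if_pos rfl]
      simp only [smul_sub, Finset.sum_sub_distrib, smul_smul, ← Finset.sum_smul] at hb
      rw [sub_smul, ← sub_eq_zero]
      rw [← sub_eq_zero] at hb
      rw [← hb]
      abel

/-- If `d` has total weight zero and nonnegative weight on all superlevel sets of `g`, then `g` and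
`d` are nonnegatively correlated. -/
theorem sum_mul_nonneg_of_superlevel {ι : Type*} [Fintype ι] {d : ι → ℝ} (g : ι → ℝ)
    (hd : ∑ e, d e = 0) (h : ∀ s : ℝ, 0 ≤ ∑ e with s ≤ g e, d e) : 0 ≤ ∑ e, g e * d e := by
  classical
  induction hk : (Finset.univ.image g).card using Nat.strong_induction_on generalizing g with
  | _ k ih =>
    rcases isEmpty_or_nonempty ι with hι | hι
    · simp
    obtain ⟨top, htop⟩ := Finite.exists_max g
    by_cases hconst : ∀ e, g e = g top
    · simp [hconst, ← Finset.mul_sum, hd]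
    push Not at hconst
    obtain ⟨e₀, he₀⟩ := hconst
    obtain ⟨p, hp, hpmax⟩ := Finset.exists_max_image (Finset.univ.filter fun e => g e ≠ g top) g
      ⟨e₀, by simpa using he₀⟩
    simp only [Finset.mem_filter, Finset.mem_univ, true_and] at hp hpmax
    have hlt : g p < g top := lt_of_le_of_ne (htop p) hp
    set g' : ι → ℝ := fun e => if g e = g top then g p else g e with hg'
    have hle : ∀ e, g' e ≤ g p := fun e => by
      simp only [hg']
      split_ifs with he
      · exact le_rfl
      · exact hpmax e he
    have hrec : 0 ≤ ∑ e, g' e * d e := by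
      refine ih _ ?_ g' (fun s => ?_) rfl
      · rw [← hk]
        refine Finset.card_lt_card ((Finset.ssubset_iff_of_subset ?_).2 ⟨g top, by simp, ?_⟩)
        · intro y hy
          obtain ⟨e, -, rfl⟩ := Finset.mem_image.1 hy
          simp only [hg']
          split_ifs <;> simp
        · intro hmem
          obtain ⟨e, -, he⟩ := Finset.mem_image.1 hmem
          exact (he ▸ hle e).not_gt hlt
      · by_cases hs : s ≤ g p
        · have : (Finset.univ.filter fun e => s ≤ g' e) = Finset.univ.filter fun e => s ≤ g e := by
            ext e
            simp only [Finset.mem_filter, Finset.mem_univ, true_and, hg']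
            split_ifs with he
            · exact ⟨fun _ => he ▸ hs.trans hlt.le, fun _ => hs⟩
            · rfl
          rw [this]
          exact h s
        · rw [Finset.filter_false_of_mem fun e _ hse => hs (hse.trans (hle e))]
          simp
    have hsplit : ∑ e, g e * d e =
        ∑ e, g' e * d e + (g top - g p) * ∑ e with g top ≤ g e, d e := by
      rw [Finset.sum_filter, Finset.mul_sum, ← Finset.sum_add_distrib]
      refine Finset.sum_congr rfl fun e _ => ?_
      simp only [hg']
      by_cases he : g e = g top
      · rw [if_pos he, if_pos he.ge, he]; ring
      · rw [if_neg he, if_neg fun h' => he (le_antisymm (htop e) h')]; ring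
    rw [hsplit]
    exact add_nonneg hrec (mul_nonneg (sub_nonneg.2 hlt.le) (h _))

/-- The balanced trinary vector attached to two sets of coordinates. -/
def trinaryVec {m : ℕ} (I J : Finset (Fin m)) : Vec m :=
  fun e => (if e ∈ I then 1 else 0) - if e ∈ J then 1 else 0

theorem sum_trinaryVec {m : ℕ} (I J N : Finset (Fin m)) :
    ∑ e ∈ N, trinaryVec I J e = ((N ∩ I).card : ℝ) - (N ∩ J).card := by
  simp [trinaryVec, Finset.sum_sub_distrib]

theorem dot_trinaryVec {m : ℕ} (v : Vec m) (I J : Finset (Fin m)) :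
    dot v (trinaryVec I J) = ∑ i ∈ I, v i - ∑ j ∈ J, v j := by
  simp [dot, trinaryVec, mul_sub, Finset.sum_sub_distrib]

theorem dot_nonpos_of_mem_coneOf {m : ℕ} {X : Set (Vec m)} {v d : Vec m} (hv : v ∈ coneOf X)
    (hX : ∀ x ∈ X, dot x d ≤ 0) : dot v d ≤ 0 := by
  obtain ⟨k, x, l, hx, hl, rfl⟩ := hv
  have : dot (∑ i, l i • x i) d = ∑ i, l i * dot (x i) d := by
    change (∑ i, l i • x i) ⬝ᵥ d = ∑ i, l i * (x i ⬝ᵥ d)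
    simp [sum_dotProduct]
  rw [this]
  exact Finset.sum_nonpos fun i _ => mul_nonpos_of_nonneg_of_nonpos (hl i) (hX _ (hx i))

/-- **Farkas' lemma** for the cone generated by a set with a finite subset of generators. -/
theorem mem_coneOf_of_dot_nonpos {m : ℕ} {X : Set (Vec m)} (s : Finset (Vec m)) (hs : ↑s ⊆ X)
    {v : Vec m} (h : ∀ d, (∀ x ∈ s, dot x d ≤ 0) → dot v d ≤ 0) : v ∈ coneOf X := by
  obtain ⟨l, hl, hv⟩ := farkas s id v h
  refine ⟨s.card, fun i => s.equivFin.symm i, fun i => l (s.equivFin.symm i),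
    fun i => hs (s.equivFin.symm i).2, fun i => hl _, ?_⟩
  rw [hv, s.equivFin.symm.sum_comp fun x : s => l x • (x : Vec m)]
  exact (Finset.sum_coe_sort s fun x => l x • x).symm

theorem dPair_or_dPair {m : ℕ} {I J : Finset (Fin m)} (hcard : I.card = J.card)
    (hdisj : Disjoint I J) (hne : I.Nonempty) : DPair I J ∨ DPair J I := by
  obtain ⟨i, hi, hmin⟩ := Finset.exists_min_image (I ∪ J) id
    (hne.mono Finset.subset_union_left)
  rcases Finset.mem_union.1 hi with h | h
  · exact Or.inl ⟨hcard, hdisj, i, h, hmin⟩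
  · exact Or.inr ⟨hcard.symm, hdisj.symm, i, h, Finset.union_comm I J ▸ hmin⟩

theorem exists_dPair_of_trinary {m : ℕ} {v : Vec m}
    (hv : ∀ I J : Finset (Fin m), DPair I J → (∑ j ∈ J, v j) < ∑ i ∈ I, v i) {u : Vec m}
    (hu : ∀ e, u e = 0 ∨ u e = 1 ∨ u e = -1) (hsum : ∑ e, u e = 0) (hpos : 0 < dot v u) :
    ∃ I J, DPair I J ∧ u = trinaryVec I J := by
  classical
  set I : Finset (Fin m) := {e | u e = 1} with hI
  set J : Finset (Fin m) := {e | u e = -1} with hJ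
  have huIJ : u = trinaryVec I J := by
    ext e
    simp only [trinaryVec, hI, hJ, Finset.mem_filter_univ]
    rcases hu e with h | h | h <;> rw [h] <;> norm_num
  have hcard : I.card = J.card := by
    rw [huIJ, sum_trinaryVec, Finset.univ_inter, Finset.univ_inter, sub_eq_zero] at hsum
    exact_mod_cast hsum
  have hdisj : Disjoint I J := Finset.disjoint_left.2 fun e h1 h2 => by
    simp only [hI, hJ, Finset.mem_filter_univ] at h1 h2
    linarith
  rw [huIJ, dot_trinaryVec] at hpos
  have hne : I.Nonempty := by
    rw [Finset.nonempty_iff_ne_empty]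
    intro h
    have hJe : J = ∅ := by rw [← Finset.card_eq_zero, ← hcard, h, Finset.card_empty]
    simp [h, hJe] at hpos
  rcases dPair_or_dPair hcard hdisj hne with h | h
  · exact ⟨I, J, h, huIJ⟩
  · linarith [hv J I h]

section operahedron

variable {n : ℕ} {t : PTree n}

theorem PTree.parent_iterate_le (t : PTree n) (k : ℕ) (w : Fin n) :
    (t.parent^[k] w).val ≤ w.val - k := by
  induction k with
  | zero => simp
  | succ k ih =>
    rw [Function.iterate_succ_apply']
    rcases Nat.eq_zero_or_pos (t.parent^[k] w).val with h | h
    · rw [t.parent_zero _ h]; omega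
    · have := t.parent_lt _ h
      omega

theorem isAnc_iff {u w : Fin n} : isAnc t u w ↔ ∃ k, t.parent^[k] w = u := by
  constructor
  · rintro ⟨k, -, h⟩
    exact ⟨k, h⟩
  · rintro ⟨k, h⟩
    by_cases hk : k ≤ n
    · exact ⟨k, Finset.mem_range.2 (by omega), h⟩
    · refine ⟨n, Finset.mem_range.2 (by omega), ?_⟩
      rw [← h]
      have h1 := t.parent_iterate_le k w
      have h2 := t.parent_iterate_le n w
      have := w.isLt
      ext
      omega

theorem isAnc_refl (u : Fin n) : isAnc t u u := isAnc_iff.2 ⟨0, rfl⟩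

theorem isAnc.le {u w : Fin n} (h : isAnc t u w) : u.val ≤ w.val := by
  obtain ⟨k, rfl⟩ := isAnc_iff.1 h
  have := t.parent_iterate_le k w
  omega

theorem isAnc_parent_iff {u w : Fin n} (h : w ≠ u) : isAnc t u w ↔ isAnc t u (t.parent w) := by
  simp only [isAnc_iff]
  constructor
  · rintro ⟨k, hk⟩
    cases k with
    | zero => exact absurd hk h
    | succ k => exact ⟨k, hk⟩
  · rintro ⟨k, hk⟩
    exact ⟨k + 1, hk⟩

theorem childV_injective : Function.Injective (childV : Fin (n - 1) → Fin n) := by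
  intro e f h
  have := congrArg Fin.val h
  simp only [childV] at this
  ext
  omega

theorem exists_childV_eq {w : Fin n} (h : 0 < w.val) : ∃ e, childV e = w :=
  ⟨⟨w.val - 1, by have := w.isLt; omega⟩, by ext; simp only [childV]; omega⟩

theorem PTree.parent_childV_lt (t : PTree n) (e : Fin (n - 1)) :
    (t.parent (childV e)).val < (childV e).val :=
  t.parent_lt _ (Nat.succ_pos _)

theorem isAnc_childV_iff {e x : Fin (n - 1)} (h : x ≠ e) :
    isAnc t (childV e) (childV x) ↔ isAnc t (childV e) (t.parent (childV x)) :=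
  isAnc_parent_iff fun h' => h (childV_injective h')

theorem not_isAnc_of_lt {u w : Fin n} (h : w.val < u.val) : ¬ isAnc t u w :=
  fun h' => h'.le.not_gt h

/-- The edges of the path joining two vertices of a tree. -/
def PTree.path (t : PTree n) (a b : Fin n) : Finset (Fin (n - 1)) :=
  Finset.univ.filter fun e => ¬ (isAnc t (childV e) a ↔ isAnc t (childV e) b)

theorem PTree.mem_path {a b : Fin n} {e : Fin (n - 1)} :
    e ∈ t.path a b ↔ ¬ (isAnc t (childV e) a ↔ isAnc t (childV e) b) := by
  simp [PTree.path]

theorem PTree.path_comm (a b : Fin n) : t.path a b = t.path b a := by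
  ext e
  simp only [PTree.mem_path]
  tauto

theorem PTree.path_self (a : Fin n) : t.path a a = ∅ := by
  ext e
  simp [PTree.mem_path]

/-- Any two edges of the set are joined by a chain of adjacent edges of the set. -/
def EdgeConnected (t : PTree n) (N : Finset (Fin (n - 1))) : Prop :=
  ∀ e ∈ N, ∀ f ∈ N, Relation.ReflTransGen (fun a b => a ∈ N ∧ b ∈ N ∧ edgeAdj t a b) e f

theorem mem_nestVtx {N : Finset (Fin (n - 1))} {a : Fin n} :
    a ∈ nestVtx t N ↔ ∃ e ∈ N, a = childV e ∨ a = t.parent (childV e) := by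
  simp [nestVtx]

theorem nestVtx_mono {N M : Finset (Fin (n - 1))} (h : N ⊆ M) : nestVtx t N ⊆ nestVtx t M :=
  Finset.biUnion_subset_biUnion_of_subset_left _ h

theorem edgeAdj_iff {e f : Fin (n - 1)} : edgeAdj t e f ↔ e ≠ f ∧
    ∃ a, (a = childV e ∨ a = t.parent (childV e)) ∧ (a = childV f ∨ a = t.parent (childV f)) := by
  simp [edgeAdj, Finset.Nonempty]

theorem edgeAdj.symm {e f : Fin (n - 1)} (h : edgeAdj t e f) : edgeAdj t f e := by
  rw [edgeAdj_iff] at h ⊢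
  obtain ⟨hne, a, h1, h2⟩ := h
  exact ⟨hne.symm, a, h2, h1⟩

theorem EdgeConnected.path_subset {N : Finset (Fin (n - 1))} (hN : EdgeConnected t N) {a b : Fin n}
    (ha : a ∈ nestVtx t N) (hb : b ∈ nestVtx t N) : t.path a b ⊆ N := by
  intro g hg
  by_contra hgN
  rw [PTree.mem_path] at hg
  obtain ⟨e, heN, hea⟩ := mem_nestVtx.1 ha
  obtain ⟨f, hfN, hfb⟩ := mem_nestVtx.1 hb
  have hend : ∀ x ∈ N, ∀ u, (u = childV x ∨ u = t.parent (childV x)) →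
      (isAnc t (childV g) u ↔ isAnc t (childV g) (childV x)) := by
    rintro x hx u (rfl | rfl)
    · rfl
    · exact (isAnc_childV_iff fun h : x = g => hgN (h ▸ hx)).symm
  have hchain : ∀ y, Relation.ReflTransGen (fun a b => a ∈ N ∧ b ∈ N ∧ edgeAdj t a b) e y →
      (isAnc t (childV g) (childV e) ↔ isAnc t (childV g) (childV y)) := by
    intro y hy
    induction hy with
    | refl => rfl
    | tail _ hxy ih =>
      obtain ⟨hx, hy, hadj⟩ := hxy
      obtain ⟨-, u, hux, huy⟩ := edgeAdj_iff.1 hadj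
      rw [ih, ← hend _ hx u hux, hend _ hy u huy]
  exact hg (by rw [hend e heN a hea, hend f hfN b hfb, hchain f (hN e heN f hfN)])

theorem EdgeConnected.insert_adj {N : Finset (Fin (n - 1))} (hN : EdgeConnected t N)
    {x y : Fin (n - 1)} (hy : y ∈ N) (hxy : edgeAdj t x y) : EdgeConnected t (insert x N) := by
  have hmono : ∀ {a b}, Relation.ReflTransGen (fun a b => a ∈ N ∧ b ∈ N ∧ edgeAdj t a b) a b →
      Relation.ReflTransGen (fun a b => a ∈ insert x N ∧ b ∈ insert x N ∧ edgeAdj t a b) a b :=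
    fun h => Relation.ReflTransGen.mono (fun a b hab =>
      ⟨Finset.mem_insert_of_mem hab.1, Finset.mem_insert_of_mem hab.2.1, hab.2.2⟩) _ _ h
  have hxy' : Relation.ReflTransGen
      (fun a b => a ∈ insert x N ∧ b ∈ insert x N ∧ edgeAdj t a b) x y :=
    .single ⟨Finset.mem_insert_self _ _, Finset.mem_insert_of_mem hy, hxy⟩
  have hyx : Relation.ReflTransGen
      (fun a b => a ∈ insert x N ∧ b ∈ insert x N ∧ edgeAdj t a b) y x :=
    .single ⟨Finset.mem_insert_of_mem hy, Finset.mem_insert_self _ _, hxy.symm⟩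
  intro e he f hf
  rcases Finset.mem_insert.1 he with rfl | heN <;> rcases Finset.mem_insert.1 hf with rfl | hfN
  · exact .refl
  · exact hxy'.trans (hmono (hN y hy f hfN))
  · exact (hmono (hN e heN y hy)).trans hyx
  · exact hmono (hN e heN f hfN)

theorem PTree.path_childV {x : Fin (n - 1)} {b : Fin n} (hb : b.val < (childV x).val) :
    t.path (childV x) b = insert x (t.path (t.parent (childV x)) b) := by
  ext e
  simp only [PTree.mem_path, Finset.mem_insert]
  by_cases h : e = x
  · subst h
    simp [isAnc_refl, not_isAnc_of_lt hb]
  · rw [isAnc_childV_iff (Ne.symm h)]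
    simp [h]

/-- A path is a connected set of edges having its two ends among its vertices. -/
theorem PTree.path_spec (t : PTree n) {a b : Fin n} (hab : a ≠ b) :
    a ∈ nestVtx t (t.path a b) ∧ b ∈ nestVtx t (t.path a b) ∧ EdgeConnected t (t.path a b) := by
  induction hk : a.val + b.val using Nat.strong_induction_on generalizing a b with
  | _ k ih =>
    wlog hlt : b.val < a.val generalizing a b
    · have := this hab.symm (by omega) (by
        have : a.val ≠ b.val := fun h => hab (Fin.ext h)
        omega)
      rw [PTree.path_comm a b]
      exact ⟨this.2.1, this.1, this.2.2⟩
    obtain ⟨x, rfl⟩ := exists_childV_eq (w := a) (by omega)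
    rw [PTree.path_childV hlt]
    have hxv : ∀ u, (u = childV x ∨ u = t.parent (childV x)) →
        u ∈ nestVtx t (insert x (t.path (t.parent (childV x)) b)) := fun u hu =>
      mem_nestVtx.2 ⟨x, Finset.mem_insert_self _ _, hu⟩
    refine ⟨hxv _ (Or.inl rfl), ?_⟩
    by_cases hpb : t.parent (childV x) = b
    · refine ⟨hxv _ (Or.inr hpb.symm), ?_⟩
      rw [hpb, PTree.path_self]
      intro e he f hf
      simp only [Finset.insert_empty, Finset.mem_singleton] at he hf
      rw [he, hf]
    · have hplt := t.parent_childV_lt x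
      obtain ⟨h1, h2, h3⟩ := ih _ (by omega) hpb rfl
      refine ⟨nestVtx_mono (Finset.subset_insert _ _) h2, ?_⟩
      obtain ⟨y, hy, hyp⟩ := mem_nestVtx.1 h1
      refine h3.insert_adj hy (edgeAdj_iff.2 ⟨?_, _, Or.inr rfl, hyp⟩)
      rintro rfl
      rw [PTree.mem_path] at hy
      exact hy (by simp [not_isAnc_of_lt hplt, not_isAnc_of_lt hlt])

/-- Two edges lie on a common path joining an end of one to an end of the other. -/
theorem PTree.exists_path (t : PTree n) (e f : Fin (n - 1)) :
    ∃ a b, (a = childV e ∨ a = t.parent (childV e)) ∧ (b = childV f ∨ b = t.parent (childV f)) ∧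
      e ∈ t.path a b ∧ f ∈ t.path a b := by
  wlog hlt : (childV e).val ≤ (childV f).val generalizing e f
  · obtain ⟨a, b, ha, hb, he, hf⟩ := this f e (by omega)
    exact ⟨b, a, hb, ha, PTree.path_comm a b ▸ hf, PTree.path_comm a b ▸ he⟩
  have hpe := t.parent_childV_lt e
  by_cases hanc : isAnc t (childV e) (childV f)
  · refine ⟨t.parent (childV e), childV f, Or.inr rfl, Or.inl rfl, ?_, ?_⟩
    · simp [PTree.mem_path, hanc, not_isAnc_of_lt hpe]
    · rw [PTree.mem_path]
      simp [isAnc_refl, not_isAnc_of_lt (hpe.trans_le hlt)]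
  · have hne : (childV e).val ≠ (childV f).val := fun h => hanc (by
      rw [Fin.ext h]; exact isAnc_refl _)
    refine ⟨childV e, childV f, Or.inl rfl, Or.inl rfl, ?_, ?_⟩
    · simp [PTree.mem_path, hanc, isAnc_refl]
    · rw [PTree.mem_path]
      simp [isAnc_refl, not_isAnc_of_lt (lt_of_le_of_ne hlt hne)]

theorem EdgeConnected.exists_path {t : PTree n} (e f : Fin (n - 1)) :
    ∃ a b, a ≠ b ∧ e ∈ t.path a b ∧ f ∈ t.path a b ∧
      ∀ N, EdgeConnected t N → e ∈ N → f ∈ N → t.path a b ⊆ N := by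
  obtain ⟨a, b, ha, hb, he, hf⟩ := t.exists_path e f
  refine ⟨a, b, ?_, he, hf, fun N hN heN hfN =>
    hN.path_subset (mem_nestVtx.2 ⟨e, heN, ha⟩) (mem_nestVtx.2 ⟨f, hfN, hb⟩)⟩
  rintro rfl
  simp [PTree.path_self] at he

theorem PTree.edgeConnected_univ (t : PTree n) : EdgeConnected t Finset.univ := by
  intro e _ f _
  obtain ⟨a, b, hab, he, hf, -⟩ := EdgeConnected.exists_path (t := t) e f
  exact Relation.ReflTransGen.mono (fun x y h => ⟨by simp, by simp, h.2.2⟩) _ _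
    ((t.path_spec hab).2.2 e he f hf)

/-- The chains of adjacent edges on which `f` is at least `f i`. -/
abbrev SuperlevelChain {α : Type*} [LinearOrder α] (t : PTree n) (f : Fin (n - 1) → α)
    (i : Fin (n - 1)) : Fin (n - 1) → Fin (n - 1) → Prop :=
  Relation.ReflTransGen fun a b => f i ≤ f a ∧ f i ≤ f b ∧ edgeAdj t a b

open Classical in
/-- The connected component of the edge `i` among the edges on which `f` is at least `f i`. -/
def superlevelNest {α : Type*} [LinearOrder α] (t : PTree n) (f : Fin (n - 1) → α)
    (i : Fin (n - 1)) : Finset (Fin (n - 1)) :=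
  Finset.univ.filter fun e => SuperlevelChain t f i i e

section superlevel

variable {α : Type*} [LinearOrder α] {f : Fin (n - 1) → α}

theorem mem_superlevelNest {i e : Fin (n - 1)} :
    e ∈ superlevelNest t f i ↔ SuperlevelChain t f i i e := by
  simp [superlevelNest]

theorem self_mem_superlevelNest (i : Fin (n - 1)) : i ∈ superlevelNest t f i :=
  mem_superlevelNest.2 .refl

theorem le_of_mem_superlevelNest {i e : Fin (n - 1)} (h : e ∈ superlevelNest t f i) :
    f i ≤ f e := by
  rcases Relation.ReflTransGen.cases_tail (mem_superlevelNest.1 h) with rfl | ⟨x, -, hx⟩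
  · exact le_rfl
  · exact hx.2.1

theorem mem_superlevelNest_of_adj {i e x : Fin (n - 1)} (he : e ∈ superlevelNest t f i)
    (hx : f i ≤ f x) (h : edgeAdj t e x) : x ∈ superlevelNest t f i :=
  mem_superlevelNest.2 ((mem_superlevelNest.1 he).tail ⟨le_of_mem_superlevelNest he, hx, h⟩)

theorem edgeConnected_superlevelNest (i : Fin (n - 1)) :
    EdgeConnected t (superlevelNest t f i) := by
  have hfrom : ∀ e, SuperlevelChain t f i i e → Relation.ReflTransGen
      (fun a b => a ∈ superlevelNest t f i ∧ b ∈ superlevelNest t f i ∧ edgeAdj t a b) i e := by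
    intro e he
    induction he with
    | refl => exact .refl
    | tail hx hxy ih =>
      exact ih.tail ⟨mem_superlevelNest.2 hx, mem_superlevelNest.2 (hx.tail hxy), hxy.2.2⟩
  have hsymm : Std.Symm fun a b =>
      a ∈ superlevelNest t f i ∧ b ∈ superlevelNest t f i ∧ edgeAdj t a b :=
    ⟨fun a b h => ⟨h.2.1, h.1, h.2.2.symm⟩⟩
  intro e he e' he'
  exact (Std.Symm.symm _ _ (hfrom e (mem_superlevelNest.1 he))).trans
    (hfrom e' (mem_superlevelNest.1 he'))

theorem EdgeConnected.subset_superlevelNest {N : Finset (Fin (n - 1))} (hN : EdgeConnected t N)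
    {i j : Fin (n - 1)} (hjN : j ∈ N) (hj : j ∈ superlevelNest t f i)
    (hf : ∀ e ∈ N, f i ≤ f e) : N ⊆ superlevelNest t f i := by
  intro e he
  have := hN j hjN e he
  induction this with
  | refl => exact hj
  | tail _ hxy ih => exact mem_superlevelNest_of_adj (ih hxy.1) (hf _ hxy.2.1) hxy.2.2

theorem superlevelNest_subset {i j : Fin (n - 1)} (h : j ∈ superlevelNest t f i) :
    superlevelNest t f j ⊆ superlevelNest t f i :=
  (edgeConnected_superlevelNest j).subset_superlevelNest (self_mem_superlevelNest j) h
    fun _ he => (le_of_mem_superlevelNest h).trans (le_of_mem_superlevelNest he)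

/-- The nesting formed by the components of the superlevel sets of an injective function. -/
def nestingOf (t : PTree n) (f : Fin (n - 1) → α) : Finset (Finset (Fin (n - 1))) :=
  Finset.univ.image (superlevelNest t f)

theorem mem_nestingOf {N : Finset (Fin (n - 1))} :
    N ∈ nestingOf t f ↔ ∃ i, superlevelNest t f i = N := by
  simp [nestingOf]

theorem superlevelNest_injective (hf : Function.Injective f) :
    Function.Injective (superlevelNest t f) := by
  intro i j h
  have h1 : j ∈ superlevelNest t f i := h ▸ self_mem_superlevelNest j
  have h2 : i ∈ superlevelNest t f j := h ▸ self_mem_superlevelNest i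
  exact hf (le_antisymm (le_of_mem_superlevelNest h1) (le_of_mem_superlevelNest h2))

theorem isMaxNesting_nestingOf (hn : 2 ≤ n) (hf : Function.Injective f) :
    IsMaxNesting t (nestingOf t f) := by
  refine ⟨⟨?_, ?_, ?_⟩, ?_⟩
  · intro N hN
    obtain ⟨i, rfl⟩ := mem_nestingOf.1 hN
    exact ⟨Or.inl ⟨i, self_mem_superlevelNest i⟩, edgeConnected_superlevelNest i⟩
  · have : Nonempty (Fin (n - 1)) := ⟨⟨0, by omega⟩⟩
    obtain ⟨i, hi⟩ := Finite.exists_min f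
    exact mem_nestingOf.2 ⟨i, Finset.eq_univ_iff_forall.2 fun e =>
      t.edgeConnected_univ.subset_superlevelNest (Finset.mem_univ i) (self_mem_superlevelNest i)
        (fun x _ => hi x) (Finset.mem_univ e)⟩
  · intro N hN M hM
    obtain ⟨i, rfl⟩ := mem_nestingOf.1 hN
    obtain ⟨j, rfl⟩ := mem_nestingOf.1 hM
    have key : ∀ i j, f i ≤ f j → superlevelNest t f j ⊆ superlevelNest t f i ∨
        (Disjoint (superlevelNest t f i) (superlevelNest t f j) ∧
          ∀ e ∈ superlevelNest t f i, ∀ x ∈ superlevelNest t f j, ¬ edgeAdj t e x) := by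
      intro i j hij
      have hle : ∀ x ∈ superlevelNest t f j, f i ≤ f x := fun x hx =>
        hij.trans (le_of_mem_superlevelNest hx)
      by_cases hex : ∃ x ∈ superlevelNest t f j, x ∈ superlevelNest t f i
      · obtain ⟨x, hxj, hxi⟩ := hex
        exact Or.inl ((edgeConnected_superlevelNest j).subset_superlevelNest hxj hxi hle)
      · push Not at hex
        exact Or.inr ⟨Finset.disjoint_right.2 hex, fun e he x hx hadj =>
          hex x hx (mem_superlevelNest_of_adj he (hle x hx) hadj)⟩
    rcases le_total (f i) (f j) with h | h
    · rcases key i j h with h1 | h1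
      · exact Or.inr (Or.inl h1)
      · exact Or.inr (Or.inr h1)
    · rcases key j i h with h1 | h1
      · exact Or.inl h1
      · exact Or.inr (Or.inr ⟨h1.1.symm, fun e he x hx hadj => h1.2 x hx e he hadj.symm⟩)
  · rw [nestingOf, Finset.card_image_of_injective _ (superlevelNest_injective hf)]
    simp

theorem minNest_nestingOf (i : Fin (n - 1)) :
    minNest (nestingOf t f) i = superlevelNest t f i := by
  apply le_antisymm
  · exact Finset.inf_le (f := id) (Finset.mem_filter.2
      ⟨mem_nestingOf.2 ⟨i, rfl⟩, self_mem_superlevelNest i⟩)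
  · refine Finset.le_inf fun N hN => ?_
    obtain ⟨hN, hi⟩ := Finset.mem_filter.1 hN
    obtain ⟨j, rfl⟩ := mem_nestingOf.1 hN
    exact superlevelNest_subset hi

/-- The depth of an edge in a nesting: the number of nests containing it. -/
def nestDepth (𝒩 : Finset (Finset (Fin (n - 1)))) (e : Fin (n - 1)) : ℕ :=
  (𝒩.filter fun N => e ∈ N).card

theorem IsNesting.subset_nestingOf {𝒩 : Finset (Finset (Fin (n - 1)))} (hn : 2 ≤ n)
    (h𝒩 : IsNesting t 𝒩)
    (hf : ∀ e x, nestDepth 𝒩 e < nestDepth 𝒩 x → f e < f x) : 𝒩 ⊆ nestingOf t f := by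
  intro N hN
  have hne : N.Nonempty := by
    rcases (h𝒩.1 N hN).1 with h | h
    · exact h
    · exact h ▸ ⟨⟨0, by omega⟩, Finset.mem_univ _⟩
  obtain ⟨i, hi, hmin⟩ := Finset.exists_min_image N f hne
  refine mem_nestingOf.2 ⟨i, Finset.Subset.antisymm ?_ ?_⟩
  · intro e he
    have hchain := mem_superlevelNest.1 he
    clear he
    induction hchain with
    | refl => exact hi
    | @tail x y _ hxy ih =>
      by_contra hyN
      refine (hf y i ?_).not_ge hxy.2.1
      refine Finset.card_lt_card ((Finset.ssubset_iff_of_subset ?_).2 ⟨N, ?_, ?_⟩)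
      · intro M hM
        obtain ⟨hM, hyM⟩ := Finset.mem_filter.1 hM
        refine Finset.mem_filter.2 ⟨hM, ?_⟩
        rcases h𝒩.2.2 N hN M hM with h | h | h
        · exact h hi
        · exact absurd (h hyM) hyN
        · exact absurd hxy.2.2 (h.2 x ih y hyM)
      · exact Finset.mem_filter.2 ⟨hN, hi⟩
      · exact fun h => hyN (Finset.mem_filter.1 h).2
  · exact EdgeConnected.subset_superlevelNest (h𝒩.1 N hN).2 hi (self_mem_superlevelNest i) hmin

end superlevel

/-- A total order on the edges refining the depth in `𝒩`, in which `e` comes first among the edges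
of its depth. -/
def depthOrder (𝒩 : Finset (Finset (Fin (n - 1)))) (e x : Fin (n - 1)) : ℕ ×ₗ ℕ :=
  toLex (nestDepth 𝒩 x, if x = e then 0 else x.val + 1)

theorem depthOrder_injective (𝒩 : Finset (Finset (Fin (n - 1)))) (e : Fin (n - 1)) :
    Function.Injective (depthOrder 𝒩 e) := by
  intro x y h
  have h2 := congrArg Prod.snd (toLex.injective h)
  dsimp only at h2
  split_ifs at h2 with h3 h4 h4
  · rw [h3, h4]
  · ext; omega

theorem depthOrder_lt (𝒩 : Finset (Finset (Fin (n - 1)))) (e x y : Fin (n - 1))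
    (h : nestDepth 𝒩 x < nestDepth 𝒩 y) : depthOrder 𝒩 e x < depthOrder 𝒩 e y :=
  Prod.Lex.toLex_lt_toLex.2 (Or.inl h)

theorem depthOrder_self_lt (𝒩 : Finset (Finset (Fin (n - 1)))) {e x : Fin (n - 1)} (hx : x ≠ e)
    (h : nestDepth 𝒩 e ≤ nestDepth 𝒩 x) : depthOrder 𝒩 e e < depthOrder 𝒩 e x := by
  rcases h.lt_or_eq with h | h
  · exact depthOrder_lt 𝒩 e e x h
  · exact Prod.Lex.toLex_lt_toLex.2 (Or.inr ⟨h, by simp [hx]⟩)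

theorem IsMaxNesting.exists_eq_nestingOf {𝒩 : Finset (Finset (Fin (n - 1)))} (hn : 2 ≤ n)
    (h : IsMaxNesting t 𝒩) :
    ∃ f : Fin (n - 1) → ℕ ×ₗ ℕ, Function.Injective f ∧ 𝒩 = nestingOf t f := by
  have e₀ : Fin (n - 1) := ⟨0, by omega⟩
  have hinj := depthOrder_injective 𝒩 e₀
  refine ⟨depthOrder 𝒩 e₀, hinj, Finset.eq_of_subset_of_card_le
    (h.1.subset_nestingOf hn (depthOrder_lt 𝒩 e₀)) ?_⟩
  rw [h.2, (isMaxNesting_nestingOf hn hinj).2]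

/-- For the vertex of the Loday realization attached to `f`, each pair of vertices `a`, `b` of the
tree contributes `ω a * ω b` to the coordinate of the edge of the path joining them on which `f` is
smallest. -/
theorem exists_pathMin_dot_MPoint {α : Type*} [LinearOrder α] {f : Fin (n - 1) → α}
    (hn : 2 ≤ n) (hf : Function.Injective f) (ω : Fin n → ℤ) :
    ∃ μ : Fin n → Fin n → Fin (n - 1),
      (∀ a b, a ≠ b → μ a b ∈ t.path a b ∧ ∀ x ∈ t.path a b, f (μ a b) ≤ f x) ∧
      ∀ c : Vec (n - 1), 2 * dot c (MPoint t (nestingOf t f) ω) =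
        ∑ a, ∑ b, if a = b then 0 else (ω a : ℝ) * ω b * c (μ a b) := by
  have hex : ∀ a b, ∃ i, a ≠ b → i ∈ t.path a b ∧ ∀ x ∈ t.path a b, f i ≤ f x := by
    intro a b
    by_cases hab : a = b
    · exact ⟨⟨0, by omega⟩, fun h => absurd hab h⟩
    · obtain ⟨e, he, -⟩ := mem_nestVtx.1 (t.path_spec hab).1
      obtain ⟨i, hi, hmin⟩ := Finset.exists_min_image (t.path a b) f ⟨e, he⟩
      exact ⟨i, fun _ => ⟨hi, hmin⟩⟩
  choose μ hμ using hex
  refine ⟨μ, hμ, fun c => ?_⟩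
  set V : Fin (n - 1) → Finset (Fin n) := fun i => nestVtx t (superlevelNest t f i) with hV
  set q : Fin (n - 1) → Fin n → Fin n → ℝ := fun i a b =>
    if (a ∈ V i ∧ isAnc t (childV i) a) ∧ b ∈ V i ∧ ¬ isAnc t (childV i) b then 1 else 0 with hq
  have hM : ∀ i, MPoint t (nestingOf t f) ω i = ∑ a, ∑ b, (ω a : ℝ) * ω b * q i a b := by
    intro i
    simp only [MPoint, alphaN, betaN, minNest_nestingOf]
    push_cast
    have hfil : ∀ (p : Fin n → Prop) [DecidablePred p], ∑ w ∈ (V i).filter p, (ω w : ℝ) =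
        ∑ w, if w ∈ V i ∧ p w then (ω w : ℝ) else 0 := fun p _ => by
      rw [← Finset.sum_filter, ← Finset.filter_filter, Finset.filter_univ_mem]
    rw [hfil, hfil, Finset.sum_mul_sum]
    refine Finset.sum_congr rfl fun a _ => Finset.sum_congr rfl fun b _ => ?_
    simp only [hq, ite_and]
    split_ifs <;> simp
  have hpair : ∀ a b, ∑ i, c i * (q i a b + q i b a) = if a = b then 0 else c (μ a b) := by
    intro a b
    split_ifs with hab
    · subst hab
      refine Finset.sum_eq_zero fun i _ => ?_
      have : q i a a = 0 := if_neg fun h => h.2.2 h.1.2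
      rw [this]; ring
    · obtain ⟨hmem, hmin⟩ := hμ a b hab
      obtain ⟨haP, hbP, hconn⟩ := t.path_spec hab
      rw [Finset.sum_eq_single (μ a b)]
      · have hsub : t.path a b ⊆ superlevelNest t f (μ a b) :=
          hconn.subset_superlevelNest hmem (self_mem_superlevelNest _) hmin
        have haV : a ∈ V (μ a b) := nestVtx_mono hsub haP
        have hbV : b ∈ V (μ a b) := nestVtx_mono hsub hbP
        rw [PTree.mem_path] at hmem
        simp only [hq, haV, hbV, true_and]
        by_cases h1 : isAnc t (childV (μ a b)) a <;> by_cases h2 : isAnc t (childV (μ a b)) b <;>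
          simp_all
      · intro i _ hi
        have key : ∀ a' b', t.path a' b' = t.path a b → q i a' b' = 0 := by
          intro a' b' hp
          refine if_neg fun h => hi ?_
          have hip : i ∈ t.path a b := by
            rw [← hp, PTree.mem_path]
            exact fun h' => h.2.2 (h'.1 h.1.2)
          have hsub := (edgeConnected_superlevelNest (t := t) (f := f) i).path_subset h.1.1 h.2.1
          rw [hp] at hsub
          exact hf (le_antisymm (le_of_mem_superlevelNest (hsub hmem)) (hmin i hip))
        rw [key a b rfl, key b a (PTree.path_comm b a)]
        ring
      · exact fun h => absurd (Finset.mem_univ _) h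
  have hswap : dot c (MPoint t (nestingOf t f) ω) =
      ∑ a, ∑ b, (ω a : ℝ) * ω b * ∑ i, c i * q i a b := by
    simp only [dot, hM, Finset.mul_sum]
    rw [Finset.sum_comm]
    refine Finset.sum_congr rfl fun a _ => ?_
    rw [Finset.sum_comm]
    refine Finset.sum_congr rfl fun b _ => Finset.sum_congr rfl fun i _ => ?_
    ring
  have hswap' : dot c (MPoint t (nestingOf t f) ω) =
      ∑ a, ∑ b, (ω a : ℝ) * ω b * ∑ i, c i * q i b a := by
    rw [hswap, Finset.sum_comm]
    refine Finset.sum_congr rfl fun a _ => Finset.sum_congr rfl fun b _ => ?_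
    ring
  rw [two_mul]
  nth_rewrite 1 [hswap]
  rw [hswap', ← Finset.sum_add_distrib]
  refine Finset.sum_congr rfl fun a _ => ?_
  rw [← Finset.sum_add_distrib]
  refine Finset.sum_congr rfl fun b _ => ?_
  rw [← mul_add, ← Finset.sum_add_distrib]
  simp only [← mul_add]
  rw [hpair]
  split_ifs <;> simp

theorem mem_normalCone_faceOfNesting {𝒩 : Finset (Finset (Fin (n - 1)))} {ω : Fin n → ℤ}
    {c : Vec (n - 1)} :
    c ∈ normalCone (Loday t ω) (faceOfNesting t ω 𝒩) ↔
      ∀ 𝒩₁, IsMaxNesting t 𝒩₁ → 𝒩 ⊆ 𝒩₁ → ∀ 𝒩₂, IsMaxNesting t 𝒩₂ →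
        dot c (MPoint t 𝒩₂ ω) ≤ dot c (MPoint t 𝒩₁ ω) := by
  have hlin : IsLinearMap ℝ (dot c) :=
    ⟨fun x y => dotProduct_add c x y, fun r x => dotProduct_smul r c x⟩
  constructor
  · intro h 𝒩₁ h₁ hsub 𝒩₂ h₂
    exact (h (subset_convexHull ℝ _ ⟨𝒩₁, h₁, hsub, rfl⟩)).2 _
      (subset_convexHull ℝ _ ⟨𝒩₂, h₂, rfl⟩)
  · intro h x hx
    refine ⟨convexHull_mono ?_ hx, fun y hy => ?_⟩
    · rintro _ ⟨𝒩₁, h₁, -, rfl⟩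
      exact ⟨𝒩₁, h₁, rfl⟩
    refine convexHull_min ?_ (convex_halfSpace_ge hlin (dot c y)) hx
    rintro _ ⟨𝒩₁, h₁, hsub, rfl⟩
    refine convexHull_min ?_ (convex_halfSpace_le hlin _) hy
    rintro _ ⟨𝒩₂, h₂, rfl⟩
    exact h 𝒩₁ h₁ hsub 𝒩₂ h₂

/-- The normal cone of the face of a nesting contains the negatives of the characteristic vectors
of its nests. -/
theorem neg_indicator_mem_normalCone (hn : 2 ≤ n) {ω : Fin n → ℤ} (hω : ∀ u, 0 < ω u)
    {𝒩 : Finset (Finset (Fin (n - 1)))} {N : Finset (Fin (n - 1))} (hN : N ∈ 𝒩) :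
    (fun i => if i ∈ N then -1 else 0 : Vec (n - 1)) ∈
      normalCone (Loday t ω) (faceOfNesting t ω 𝒩) := by
  refine mem_normalCone_faceOfNesting.2 fun 𝒩₁ h₁ hsub 𝒩₂ h₂ => ?_
  obtain ⟨f, hf, rfl⟩ := h₁.exists_eq_nestingOf hn
  obtain ⟨g, hg, rfl⟩ := h₂.exists_eq_nestingOf hn
  obtain ⟨μ, hμ, hμM⟩ := exists_pathMin_dot_MPoint (t := t) hn hf ω
  obtain ⟨ν, hν, hνM⟩ := exists_pathMin_dot_MPoint (t := t) hn hg ω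
  obtain ⟨j, rfl⟩ := mem_nestingOf.1 (hsub hN)
  refine le_of_mul_le_mul_left (a := (2 : ℝ)) ?_ two_pos
  rw [hμM, hνM]
  refine Finset.sum_le_sum fun a _ => Finset.sum_le_sum fun b _ => ?_
  by_cases hab : a = b
  · rw [if_pos hab, if_pos hab]
  rw [if_neg hab, if_neg hab]
  refine mul_le_mul_of_nonneg_left ?_
    (mul_nonneg (Int.cast_nonneg (hω a).le) (Int.cast_nonneg (hω b).le))
  by_cases h : μ a b ∈ superlevelNest t f j
  · have hνN : ν a b ∈ superlevelNest t f j := superlevelNest_subset h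
      ((t.path_spec hab).2.2.subset_superlevelNest (hμ a b hab).1 (self_mem_superlevelNest _)
        (hμ a b hab).2 (hν a b hab).1)
    simp [h, hνN]
  · simp only [h, if_false]
    split_ifs <;> norm_num

/-- A functional in the normal cone of the face of a nesting is monotone along the inclusion of the
sets of nests containing the edges. -/
theorem le_of_mem_normalCone (hn : 2 ≤ n) {ω : Fin n → ℤ} (hω : ∀ u, 0 < ω u)
    {𝒩 : Finset (Finset (Fin (n - 1)))} (h𝒩 : IsNesting t 𝒩) {c : Vec (n - 1)}
    (hc : c ∈ normalCone (Loday t ω) (faceOfNesting t ω 𝒩)) {e e' : Fin (n - 1)}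
    (h : ∀ M ∈ 𝒩, e ∈ M → e' ∈ M) : c e' ≤ c e := by
  have hf := depthOrder_injective 𝒩 e
  let g : Fin (n - 1) → ℝ ×ₗ Fin (n - 1) := fun x => toLex (-c x, x)
  have hg : Function.Injective g := fun x y hxy => congrArg Prod.snd (toLex.injective hxy)
  have hgc : ∀ x y, g x ≤ g y → c y ≤ c x := fun x y hxy => by
    have : -c x ≤ -c y := (Prod.Lex.toLex_le_toLex.1 hxy).elim le_of_lt fun h => h.1.le
    linarith
  have hle := mem_normalCone_faceOfNesting.1 hc _ (isMaxNesting_nestingOf (t := t) hn hf)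
    (h𝒩.subset_nestingOf hn (depthOrder_lt 𝒩 e)) _ (isMaxNesting_nestingOf (t := t) hn hg)
  obtain ⟨μ, hμ, hμM⟩ := exists_pathMin_dot_MPoint (t := t) hn hf ω
  obtain ⟨ν, hν, hνM⟩ := exists_pathMin_dot_MPoint (t := t) hn hg ω
  obtain ⟨a, b, hab, hea, he'a, hpath⟩ := EdgeConnected.exists_path (t := t) e e'
  have hμe : μ a b = e := by
    by_contra hne
    refine ((hμ a b hab).2 e hea).not_gt (depthOrder_self_lt 𝒩 hne (Finset.card_le_card ?_))
    intro M hM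
    obtain ⟨hM, heM⟩ := Finset.mem_filter.1 hM
    exact Finset.mem_filter.2
      ⟨hM, hpath M (h𝒩.1 M hM).2 heM (h M hM heM) (hμ a b hab).1⟩
  have hlt : ¬ c (μ a b) < c (ν a b) := by
    intro hlt
    have hterm : ∀ a b, (if a = b then 0 else (ω a : ℝ) * ω b * c (μ a b)) ≤
        if a = b then 0 else (ω a : ℝ) * ω b * c (ν a b) := by
      intro a b
      split_ifs with hab
      · exact le_rfl
      · exact mul_le_mul_of_nonneg_left (hgc _ _ ((hν a b hab).2 _ (hμ a b hab).1))
          (mul_nonneg (Int.cast_nonneg (hω a).le) (Int.cast_nonneg (hω b).le))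
    have : 2 * dot c (MPoint t (nestingOf t (depthOrder 𝒩 e)) ω) <
        2 * dot c (MPoint t (nestingOf t g) ω) := by
      rw [hμM, hνM]
      refine Finset.sum_lt_sum (fun a _ => Finset.sum_le_sum fun b _ => hterm a b)
        ⟨a, Finset.mem_univ a, Finset.sum_lt_sum (fun b _ => hterm a b)
          ⟨b, Finset.mem_univ b, ?_⟩⟩
      rw [if_neg hab, if_neg hab]
      exact mul_lt_mul_of_pos_left hlt
        (mul_pos (Int.cast_pos.2 (hω a)) (Int.cast_pos.2 (hω b)))
    linarith
  rw [hμe] at hlt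
  exact (hgc _ _ ((hν a b hab).2 e' he'a)).trans (not_lt.1 hlt)

theorem IsNesting.laminar {𝒩 : Finset (Finset (Fin (n - 1)))} (h𝒩 : IsNesting t 𝒩) :
    Laminar 𝒩 := fun N hN M hM =>
  (h𝒩.2.2 N hN M hM).imp_right fun h => h.imp_right And.left

theorem dot_nonpos_of_mem_normalCone (hn : 2 ≤ n) {ω : Fin n → ℤ} (hω : ∀ u, 0 < ω u)
    {𝒩 : Finset (Finset (Fin (n - 1)))} (h𝒩 : IsNesting t 𝒩) {c d : Vec (n - 1)}
    (hc : c ∈ normalCone (Loday t ω) (faceOfNesting t ω 𝒩)) (hd : ∑ e, d e = 0)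
    (hdN : ∀ N ∈ 𝒩, 0 ≤ ∑ e ∈ N, d e) : dot c d ≤ 0 := by
  have hnonneg : 0 ≤ ∑ e, (-c e) * d e := by
    refine sum_mul_nonneg_of_superlevel _ hd fun s => ?_
    set S : Finset (Fin (n - 1)) := {e | s ≤ -c e} with hS
    have hunion : S = (𝒩.filter (· ⊆ S)).biUnion id := by
      refine Finset.Subset.antisymm (fun e he => ?_) ?_
      · obtain ⟨N, hN, hmin⟩ := Finset.exists_min_image (𝒩.filter (e ∈ ·)) Finset.card
          ⟨_, Finset.mem_filter.2 ⟨h𝒩.2.1, Finset.mem_univ e⟩⟩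
        obtain ⟨hN, heN⟩ := Finset.mem_filter.1 hN
        have hsub : ∀ M ∈ 𝒩, e ∈ M → N ⊆ M := by
          intro M hM heM
          rcases h𝒩.laminar N hN M hM with h | h | h
          · exact h
          · exact (Finset.eq_of_subset_of_card_le h
              (hmin M (Finset.mem_filter.2 ⟨hM, heM⟩))).ge
          · exact absurd heM (Finset.disjoint_left.1 h heN)
        refine Finset.mem_biUnion.2 ⟨N, Finset.mem_filter.2 ⟨hN, fun x hx => ?_⟩, heN⟩
        have hx' := le_of_mem_normalCone hn hω h𝒩 hc fun M hM heM => hsub M hM heM hx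
        simp only [hS, Finset.mem_filter_univ] at he ⊢
        linarith
      · exact Finset.biUnion_subset.2 fun N hN => (Finset.mem_filter.1 hN).2
    rw [hunion]
    exact (h𝒩.laminar.mono (Finset.filter_subset _ _)).sum_biUnion_nonneg
      fun N hN => hdN N (Finset.mem_filter.1 hN).1
  simp only [neg_mul, Finset.sum_neg_distrib] at hnonneg
  exact neg_nonneg.1 hnonneg

end operahedron

/-- Universal formula for the operahedra. Let `P = P_{(t,ω)}` be the Loday
realization of the operahedron of a planar tree `t ∈ PT_n` with weight `ω`, and let `v` be a
principal orientation vector (`Σ_{i ∈ I} v_i > Σ_{j ∈ J} v_j` for all `(I, J) ∈ D(n-1)`). For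
faces `F, G` of `P` associated to the nestings `𝒩, 𝒩'`, one has `(F, G) ∈ Im Δ_{(P,v)}`
(i.e. `v ∈ cone(-N_P(F) ∪ N_P(G))`) if and only if for every `(I, J) ∈ D(n-1)` there is a nest
`N ∈ 𝒩` with `|N ∩ I| > |N ∩ J|` or a nest `N' ∈ 𝒩'` with `|N' ∩ I| < |N' ∩ J|`. -/
theorem stmt19 {n : ℕ} (hn : 2 ≤ n) (t : PTree n) (ω : Fin n → ℤ) (hω : ∀ u, 0 < ω u)
    (v : Vec (n - 1))
    (hv : ∀ I J : Finset (Fin (n - 1)), DPair I J → (∑ j ∈ J, v j) < ∑ i ∈ I, v i)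
    (𝒩 𝒩' : Finset (Finset (Fin (n - 1))))
    (h𝒩 : IsNesting t 𝒩) (h𝒩' : IsNesting t 𝒩') :
    v ∈ coneOf ((Neg.neg '' normalCone (Loday t ω) (faceOfNesting t ω 𝒩)) ∪
        normalCone (Loday t ω) (faceOfNesting t ω 𝒩')) ↔
      ∀ I J : Finset (Fin (n - 1)), DPair I J →
        (∃ N ∈ 𝒩, (N ∩ J).card < (N ∩ I).card) ∨
        (∃ N' ∈ 𝒩', (N' ∩ I).card < (N' ∩ J).card) := by
  constructor
  · intro hmem I J hIJ
    by_contra! hcon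
    obtain ⟨hN, hN'⟩ := hcon
    have hd : ∑ e, trinaryVec I J e = 0 := by simp [sum_trinaryVec, hIJ.1]
    have hle : dot v (trinaryVec I J) ≤ 0 := by
      refine dot_nonpos_of_mem_coneOf hmem ?_
      rintro _ (⟨c, hc, rfl⟩ | hx)
      · have := dot_nonpos_of_mem_normalCone hn hω h𝒩 (d := -trinaryVec I J) hc (by simp [hd])
          fun N hN𝒩 => by
            have h : ((N ∩ I).card : ℝ) ≤ (N ∩ J).card := by exact_mod_cast hN N hN𝒩
            simp only [Pi.neg_apply, Finset.sum_neg_distrib, sum_trinaryVec]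
            linarith
        simpa [dot] using this
      · refine dot_nonpos_of_mem_normalCone hn hω h𝒩' hx hd fun N hN𝒩 => ?_
        have h : ((N ∩ J).card : ℝ) ≤ (N ∩ I).card := by exact_mod_cast hN' N hN𝒩
        rw [sum_trinaryVec]
        linarith
    rw [dot_trinaryVec] at hle
    linarith [hv I J hIJ]
  · intro hIJ
    let χ : Finset (Fin (n - 1)) → Vec (n - 1) := fun N i => if i ∈ N then -1 else 0
    have hχ : ∀ N d, dot (χ N) d = -∑ e ∈ N, d e := fun N d => by simp [dot, χ, ite_mul]
    have hχ' : ∀ N d, dot (-χ N) d = ∑ e ∈ N, d e := fun N d => by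
      rw [← neg_neg (∑ e ∈ N, d e), ← hχ]
      exact neg_dotProduct (χ N) d
    refine mem_coneOf_of_dot_nonpos (𝒩.image (fun N => -χ N) ∪ 𝒩'.image χ) ?_ fun d hd => ?_
    · intro x hx
      rcases Finset.mem_union.1 (Finset.mem_coe.1 hx) with hx | hx
      · obtain ⟨N, hN, rfl⟩ := Finset.mem_image.1 hx
        exact Or.inl ⟨χ N, neg_indicator_mem_normalCone hn hω hN, rfl⟩
      · obtain ⟨N, hN, rfl⟩ := Finset.mem_image.1 hx
        exact Or.inr (neg_indicator_mem_normalCone hn hω hN)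
    · by_contra! hpos
      have hdA : ∀ N ∈ 𝒩, ∑ e ∈ N, d e ≤ 0 := fun N hN => hχ' N d ▸
        hd _ (Finset.mem_union_left _ (Finset.mem_image_of_mem _ hN))
      have hdB : ∀ N ∈ 𝒩', 0 ≤ ∑ e ∈ N, d e := fun N hN => neg_nonpos.1 <| hχ N d ▸
        hd _ (Finset.mem_union_right _ (Finset.mem_image_of_mem _ hN))
      obtain ⟨u, hu, huA, huB, hupos⟩ := exists_trinary_of_pos h𝒩.laminar h𝒩'.laminar
        h𝒩.2.1 h𝒩'.2.1 v hdA hdB hpos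
      obtain ⟨I, J, hD, rfl⟩ := exists_dPair_of_trinary hv hu
        (le_antisymm (huA _ h𝒩.2.1) (huB _ h𝒩'.2.1)) hupos
      rcases hIJ I J hD with ⟨N, hN, hlt⟩ | ⟨N, hN, hlt⟩
      · have h := huA N hN
        rw [sum_trinaryVec, sub_nonpos] at h
        exact absurd hlt (by exact_mod_cast h.not_gt)
      · have h := huB N hN
        rw [sum_trinaryVec, sub_nonneg] at h
        exact absurd hlt (by exact_mod_cast h.not_gt)

end
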